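/- (Proposition 4.1, normalization factor.) Let θ ∈ (0,π), γ > 1, β > 0, ε > 0 and x ∈ ℝ, and set μ = e^{-4εβ} ∈ (0,1) and z = -4μ sin²θ / (1-μ)². Then the series ∑_{m=0}^∞ (m!/(γ)_m) · μ^m · (P_m^{(γ/2)}(x,θ))² converges absolutely, and e^{-2εβγ} · ∑_{m=0}^∞ (m!/(γ)_m) μ^m (P_m^{(γ/2)}(x,θ))² = ((1 - μ e^{2iθ})/(1-μ))^{2ix} · (2 sinh(2εβ))^{-γ} · F(z), where F(z) = (Γ(γ)/(Γ(γ/2+ix)Γ(γ/2-ix))) · ∫_0^1 t^{γ/2+ix-1} (1-t)^{γ/2-ix-1} (1-zt)^{-(γ/2+ix)} dt is the Euler-integral representation of the Gauss hypergeometric function ₂F₁(γ/2+ix, γ/2+ix; γ; z), and all complex powers are taken with the principal branch. -/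

import Mathlib

open MeasureTheory Real Set

noncomputable section

/-- Complex Pochhammer symbol `(a)_k`. -/
def pochC (a : ℂ) (k : ℕ) : ℂ := ∏ i ∈ Finset.range k, (a + i)

/-- Real Pochhammer symbol `(a)_k`. -/
def pochR (a : ℝ) (k : ℕ) : ℝ := ∏ i ∈ Finset.range k, (a + i)

/-- Meixner–Pollaczek polynomial `P_m^{(λ)}(x,θ)`. -/
def meixnerPollaczek (lam θ x : ℝ) (m : ℕ) : ℂ :=
  (pochC (2 * lam) m / m.factorial) * Complex.exp (Complex.I * m * θ) *
    ∑ k ∈ Finset.range (m + 1),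
      pochC (-(m : ℂ)) k * pochC (lam + Complex.I * x) k /
        (pochC (2 * lam) k * k.factorial) *
        (1 - Complex.exp (-2 * Complex.I * θ)) ^ k

theorem pochC_succ (a : ℂ) (k : ℕ) : pochC a (k + 1) = pochC a k * (a + k) :=
  Finset.prod_range_succ _ _

theorem pochC_ne_zero {a : ℂ} (ha : 0 < a.re) (k : ℕ) : pochC a k ≠ 0 := by
  refine Finset.prod_ne_zero_iff.2 fun i _ h => ?_
  have h' := congrArg Complex.re h
  simp only [Complex.add_re, Complex.natCast_re, Complex.zero_re] at h'
  have : (0 : ℝ) ≤ i := i.cast_nonneg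
  linarith

theorem Gamma_add_natCast {a : ℂ} (ha : 0 < a.re) (k : ℕ) :
    Complex.Gamma (a + k) = pochC a k * Complex.Gamma a := by
  induction k with
  | zero => simp [pochC]
  | succ k ih =>
    have h0 : a + k ≠ 0 := by
      intro h
      have h' := congrArg Complex.re h
      simp only [Complex.add_re, Complex.natCast_re, Complex.zero_re] at h'
      have : (0 : ℝ) ≤ k := k.cast_nonneg
      linarith
    rw [Nat.cast_succ, ← add_assoc, Complex.Gamma_add_one _ h0, ih, pochC_succ]
    ring

theorem pochC_neg_natCast {m k : ℕ} (hk : k ≤ m) :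
    pochC (-(m : ℂ)) k = (-1) ^ k * k.factorial * m.choose k := by
  induction k with
  | zero => simp [pochC]
  | succ k ih =>
    have h := Nat.choose_succ_right_eq m k
    have h' : (m.choose (k + 1) : ℂ) * (k + 1) = m.choose k * (m - k) := by
      rw [← Nat.cast_sub (by omega)]
      exact_mod_cast h
    rw [pochC_succ, ih (by omega), Nat.factorial_succ]
    push_cast
    linear_combination (-1) ^ k * (k.factorial : ℂ) * h'

theorem choose_eq_pochC_div (a : ℂ) (k : ℕ) :
    Ring.choose (a + k - 1) k = pochC a k / k.factorial := by
  rw [eq_div_iff (by exact_mod_cast k.factorial_ne_zero), mul_comm, ← Ring.multichoose_eq,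
    ← nsmul_eq_mul, Ring.factorial_nsmul_multichoose_eq_ascPochhammer]
  induction k with
  | zero => simp [pochC]
  | succ k ih =>
    rw [pochC_succ, ascPochhammer_succ_right, Polynomial.smeval_mul, ih]
    simp [Polynomial.smeval_add, Polynomial.smeval_natCast]

theorem hasSum_pochC_mul_pow (a : ℂ) {T : ℂ} (hT : ‖T‖ < 1) :
    HasSum (fun k : ℕ => pochC a k / k.factorial * T ^ k) ((1 - T) ^ (-a)) := by
  have h := (Complex.one_div_one_sub_cpow_hasFPowerSeriesOnBall_zero a).hasSum (y := T)
    (by simpa [enorm_eq_nnnorm, ← NNReal.coe_lt_coe] using hT)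
  simpa [FormalMultilinearSeries.ofScalars_apply_eq, choose_eq_pochC_div, Complex.cpow_neg, mul_comm] using h

theorem summable_norm_pochC_mul_pow (a : ℂ) {T : ℂ} (hT : ‖T‖ < 1) :
    Summable fun k : ℕ => ‖pochC a k / k.factorial * T ^ k‖ := by
  have h := Complex.one_div_one_sub_cpow_hasFPowerSeriesOnBall_zero a
  have h' := FormalMultilinearSeries.summable_norm_apply _ (x := T)
    (Metric.eball_subset_eball h.r_le
      (by simpa [enorm_eq_nnnorm, ← NNReal.coe_lt_coe] using hT))
  simpa [FormalMultilinearSeries.ofScalars_apply_eq, choose_eq_pochC_div, mul_comm] using h'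

/-- The (complex) beta density, without its normalization. -/
def betaWeight (a b : ℂ) (t : ℝ) : ℂ := (t : ℂ) ^ (a - 1) * (1 - (t : ℂ)) ^ (b - 1)

/-- The mean of `f` against the normalized complex beta density. -/
def betaMean (a b : ℂ) (f : ℝ → ℂ) : ℂ :=
  Complex.Gamma (a + b) / (Complex.Gamma a * Complex.Gamma b) *
    ∫ t in (0 : ℝ)..1, betaWeight a b t * f t

section Beta

variable {a b : ℂ}

theorem intervalIntegrable_betaWeight (ha : 0 < a.re) (hb : 0 < b.re) :
    IntervalIntegrable (betaWeight a b) volume 0 1 :=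
  Complex.betaIntegral_convergent ha hb

theorem intervalIntegrable_betaWeight_mul (ha : 0 < a.re) (hb : 0 < b.re) {f : ℝ → ℂ}
    (hf : ContinuousOn f (Icc 0 1)) :
    IntervalIntegrable (fun t => betaWeight a b t * f t) volume 0 1 :=
  (intervalIntegrable_betaWeight ha hb).mul_continuousOn (by rwa [uIcc_of_le zero_le_one])

theorem betaMean_const_mul (c : ℂ) (f : ℝ → ℂ) :
    betaMean a b (fun t => c * f t) = c * betaMean a b f := by
  simp only [betaMean, mul_left_comm _ c, intervalIntegral.integral_const_mul]

theorem betaMean_sum (ha : 0 < a.re) (hb : 0 < b.re) {ι : Type*} (s : Finset ι) {f : ι → ℝ → ℂ}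
    (hf : ∀ i ∈ s, ContinuousOn (f i) (Icc 0 1)) :
    betaMean a b (fun t => ∑ i ∈ s, f i t) = ∑ i ∈ s, betaMean a b (f i) := by
  simp only [betaMean, Finset.mul_sum]
  rw [intervalIntegral.integral_finsetSum
    fun i hi => intervalIntegrable_betaWeight_mul ha hb (hf i hi), Finset.mul_sum]

theorem betaMean_pow_mul_pow (ha : 0 < a.re) (hb : 0 < b.re) (i j : ℕ) :
    betaMean a b (fun t => (t : ℂ) ^ i * (1 - (t : ℂ)) ^ j) =
      pochC a i * pochC b j / pochC (a + b) (i + j) := by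
  have hai : 0 < (a + i).re := by simp; positivity
  have hbj : 0 < (b + j).re := by simp; positivity
  have hab : 0 < (a + b).re := by simp; positivity
  have key : ∫ t in (0 : ℝ)..1, betaWeight a b t * ((t : ℂ) ^ i * (1 - (t : ℂ)) ^ j) =
      Complex.betaIntegral (a + i) (b + j) := by
    rw [Complex.betaIntegral, intervalIntegral.integral_of_le zero_le_one,
      intervalIntegral.integral_of_le zero_le_one, integral_Ioc_eq_integral_Ioo,
      integral_Ioc_eq_integral_Ioo]
    refine setIntegral_congr_fun measurableSet_Ioo fun t ht => ?_
    have h0 : (t : ℂ) ≠ 0 := by exact_mod_cast ht.1.ne'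
    have h1 : (1 - t : ℂ) ≠ 0 := by exact_mod_cast (sub_pos.2 ht.2).ne'
    simp only [betaWeight]
    rw [add_sub_right_comm a, add_sub_right_comm b, Complex.cpow_add _ _ h0,
      Complex.cpow_add _ _ h1, Complex.cpow_natCast, Complex.cpow_natCast]
    ring
  have hG := Complex.Gamma_mul_Gamma_eq_betaIntegral hai hbj
  have e : a + i + (b + j) = a + b + ((i + j : ℕ) : ℂ) := by push_cast; ring
  rw [e, Gamma_add_natCast ha, Gamma_add_natCast hb, Gamma_add_natCast hab] at hG
  rw [betaMean, key]
  have := Complex.Gamma_ne_zero_of_re_pos ha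
  have := Complex.Gamma_ne_zero_of_re_pos hb
  have := Complex.Gamma_ne_zero_of_re_pos hab
  have := pochC_ne_zero hab (i + j)
  field_simp
  linear_combination -hG

theorem summable_norm_and_hasSum_betaMean (ha : 0 < a.re) (hb : 0 < b.re) {f : ℕ → ℝ → ℂ}
    {g : ℝ → ℂ} {B : ℕ → ℝ} (hf : ∀ n, ContinuousOn (f n) (Icc 0 1)) (hB : Summable B)
    (hfB : ∀ n, ∀ t ∈ Icc (0 : ℝ) 1, ‖f n t‖ ≤ B n)
    (hg : ∀ t ∈ Icc (0 : ℝ) 1, HasSum (fun n => f n t) (g t)) :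
    (Summable fun n => ‖betaMean a b (f n)‖) ∧
      HasSum (fun n => betaMean a b (f n)) (betaMean a b g) := by
  have hw := intervalIntegrable_betaWeight ha hb
  have hI : uIoc (0 : ℝ) 1 = Ioc 0 1 := uIoc_of_le zero_le_one
  have hle : ∀ n, ∀ t ∈ Ioc (0 : ℝ) 1, ‖betaWeight a b t * f n t‖ ≤ ‖betaWeight a b t‖ * B n :=
    fun n t ht => by
      rw [norm_mul]
      exact mul_le_mul_of_nonneg_left (hfB n t (Ioc_subset_Icc_self ht)) (norm_nonneg _)
  constructor
  · refine Summable.of_nonneg_of_le (fun _ => norm_nonneg _) (fun n => ?_)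
      ((hB.mul_left (∫ t in (0 : ℝ)..1, ‖betaWeight a b t‖)).mul_left
        ‖Complex.Gamma (a + b) / (Complex.Gamma a * Complex.Gamma b)‖)
    rw [betaMean, norm_mul, ← intervalIntegral.integral_mul_const]
    exact mul_le_mul_of_nonneg_left
      (intervalIntegral.norm_integral_le_of_norm_le zero_le_one
        (Filter.Eventually.of_forall (hle n)) (hw.norm.mul_const _)) (norm_nonneg _)
  · refine HasSum.mul_left _ ?_
    refine intervalIntegral.hasSum_integral_of_dominated_convergence
      (fun n t => ‖betaWeight a b t‖ * B n)
      (fun n => (intervalIntegrable_betaWeight_mul ha hb (hf n)).def'.aestronglyMeasurable)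
      (fun n => Filter.Eventually.of_forall fun t ht => hle n t (hI ▸ ht))
      (Filter.Eventually.of_forall fun t _ => hB.mul_left _) ?_ ?_
    · simp only [tsum_mul_left]
      exact hw.norm.mul_const _
    · exact Filter.Eventually.of_forall fun t ht =>
        (hg t (Ioc_subset_Icc_self (hI ▸ ht))).mul_left _

end Beta

section MeixnerPollaczek

variable {lam : ℝ}

theorem meixnerPollaczek_eq_betaMean (hlam : 0 < lam) (θ x : ℝ) (m : ℕ) :
    meixnerPollaczek lam θ x m =
      pochC (2 * lam) m / m.factorial * Complex.exp (Complex.I * m * θ) *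
        betaMean (lam + Complex.I * x) (lam - Complex.I * x)
          (fun t => ((1 - t) + Complex.exp (-2 * Complex.I * θ) * t) ^ m) := by
  have ha : 0 < (lam + Complex.I * x : ℂ).re := by simpa
  have hb : 0 < (lam - Complex.I * x : ℂ).re := by simpa
  have hab : (lam + Complex.I * x : ℂ) + (lam - Complex.I * x) = 2 * lam := by ring
  rw [meixnerPollaczek]
  congr 1
  set s := 1 - Complex.exp (-2 * Complex.I * θ) with hs
  have hexp : ∀ t : ℝ, ((1 - t) + Complex.exp (-2 * Complex.I * θ) * t : ℂ) ^ m =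
      ∑ k ∈ Finset.range (m + 1),
        ((-s) ^ k * m.choose k) * ((t : ℂ) ^ k * (1 - (t : ℂ)) ^ 0) := by
    intro t
    have : (1 - t) + Complex.exp (-2 * Complex.I * θ) * t = -s * t + 1 := by rw [hs]; ring
    rw [this, add_pow]
    refine Finset.sum_congr rfl fun k _ => ?_
    rw [mul_pow]
    ring
  simp only [hexp]
  rw [betaMean_sum ha hb _ fun k _ => by fun_prop]
  refine Finset.sum_congr rfl fun k hk => ?_
  rw [betaMean_const_mul, betaMean_pow_mul_pow ha hb, hab,
    pochC_neg_natCast (Nat.lt_succ_iff.1 (Finset.mem_range.1 hk)), neg_pow s]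
  have := pochC_ne_zero (a := 2 * lam) (by simpa) k
  have : (k.factorial : ℂ) ≠ 0 := by exact_mod_cast k.factorial_ne_zero
  simp only [pochC, Finset.range_zero, Finset.prod_empty, add_zero] at *
  field_simp

theorem meixnerPollaczek_eq_sum_antidiagonal (hlam : 0 < lam) (θ x : ℝ) (m : ℕ) :
    meixnerPollaczek lam θ x m = ∑ p ∈ Finset.HasAntidiagonal.antidiagonal m,
      pochC (lam - Complex.I * x) p.1 / p.1.factorial * Complex.exp (Complex.I * θ) ^ p.1 *
        (pochC (lam + Complex.I * x) p.2 / p.2.factorial *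
          Complex.exp (-(Complex.I * θ)) ^ p.2) := by
  have ha : 0 < (lam + Complex.I * x : ℂ).re := by simpa
  have hb : 0 < (lam - Complex.I * x : ℂ).re := by simpa
  have hab : (lam + Complex.I * x : ℂ) + (lam - Complex.I * x) = 2 * lam := by ring
  rw [meixnerPollaczek_eq_betaMean hlam]
  have hexp : ∀ t : ℝ, ((1 - t) + Complex.exp (-2 * Complex.I * θ) * t : ℂ) ^ m =
      ∑ p ∈ Finset.HasAntidiagonal.antidiagonal m, (m.choose p.1 * Complex.exp (-2 * Complex.I * θ) ^ p.2) *
        ((t : ℂ) ^ p.2 * (1 - (t : ℂ)) ^ p.1) := by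
    intro t
    rw [(Commute.all _ _).add_pow']
    refine Finset.sum_congr rfl fun p _ => ?_
    rw [mul_pow, nsmul_eq_mul]
    ring
  simp only [hexp]
  rw [betaMean_sum ha hb _ fun k _ => by fun_prop, Finset.mul_sum]
  refine Finset.sum_congr rfl fun p hp => ?_
  obtain ⟨i, j⟩ := p
  obtain rfl : i + j = m := by simpa using hp
  rw [betaMean_const_mul, betaMean_pow_mul_pow ha hb, hab]
  have h1 : Complex.exp (Complex.I * (i + j : ℕ) * θ) =
      Complex.exp (Complex.I * θ) ^ i * Complex.exp (Complex.I * θ) ^ j := by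
    rw [← pow_add, ← Complex.exp_nat_mul]; congr 1; ring
  have h2 : Complex.exp (-2 * Complex.I * θ) = Complex.exp (-(Complex.I * θ)) ^ 2 := by
    rw [← Complex.exp_nat_mul]; congr 1; push_cast; ring
  have h3 : Complex.exp (Complex.I * θ) ^ j * (Complex.exp (-(Complex.I * θ)) ^ 2) ^ j =
      Complex.exp (-(Complex.I * θ)) ^ j := by
    rw [← mul_pow, pow_two, ← mul_assoc, ← Complex.exp_add]; simp
  have h4 : ((i + j).choose i : ℂ) * i.factorial * j.factorial = (i + j).factorial := by
    rw [Nat.choose_symm_add]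
    exact_mod_cast Nat.add_choose_mul_factorial_mul_factorial i j
  have := pochC_ne_zero (a := 2 * lam) (by simpa) (i + j)
  have : (i.factorial : ℂ) ≠ 0 := by exact_mod_cast i.factorial_ne_zero
  have : (j.factorial : ℂ) ≠ 0 := by exact_mod_cast j.factorial_ne_zero
  have : ((i + j).factorial : ℂ) ≠ 0 := by exact_mod_cast (i + j).factorial_ne_zero
  rw [h1, h2, add_comm j i]
  simp only
  rw [← h3, ← h4]
  have : ((i + j).choose i : ℂ) ≠ 0 := by
    intro h; rw [h] at h4; simp_all
  field_simp

theorem summable_norm_and_hasSum_meixnerPollaczek (hlam : 0 < lam) (θ x : ℝ) {T : ℂ}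
    (hT : ‖T‖ < 1) :
    (Summable fun m => ‖meixnerPollaczek lam θ x m * T ^ m‖) ∧
      HasSum (fun m => meixnerPollaczek lam θ x m * T ^ m)
        ((1 - Complex.exp (Complex.I * θ) * T) ^ (-(lam - Complex.I * x)) *
          (1 - Complex.exp (-(Complex.I * θ)) * T) ^ (-(lam + Complex.I * x))) := by
  have hT1 : ‖Complex.exp (Complex.I * θ) * T‖ < 1 := by
    rwa [norm_mul, mul_comm Complex.I, Complex.norm_exp_ofReal_mul_I, one_mul]
  have hT2 : ‖Complex.exp (-(Complex.I * θ)) * T‖ < 1 := by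
    have : -(Complex.I * θ) = ((-θ : ℝ) : ℂ) * Complex.I := by push_cast; ring
    rwa [norm_mul, this, Complex.norm_exp_ofReal_mul_I, one_mul]
  have s1 := summable_norm_pochC_mul_pow (lam - Complex.I * x) hT1
  have s2 := summable_norm_pochC_mul_pow (lam + Complex.I * x) hT2
  have hterm : ∀ m, meixnerPollaczek lam θ x m * T ^ m =
      ∑ p ∈ Finset.HasAntidiagonal.antidiagonal m,
        pochC (lam - Complex.I * x) p.1 / p.1.factorial *
          (Complex.exp (Complex.I * θ) * T) ^ p.1 *
        (pochC (lam + Complex.I * x) p.2 / p.2.factorial *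
          (Complex.exp (-(Complex.I * θ)) * T) ^ p.2) := by
    intro m
    rw [meixnerPollaczek_eq_sum_antidiagonal hlam, Finset.sum_mul]
    refine Finset.sum_congr rfl fun p hp => ?_
    rw [← Finset.HasAntidiagonal.mem_antidiagonal.1 hp, pow_add, mul_pow, mul_pow]
    ring
  have s := summable_norm_sum_mul_antidiagonal_of_summable_norm s1 s2
  simp only [← hterm] at s
  refine ⟨s, ?_⟩
  have h := tsum_mul_tsum_eq_tsum_sum_antidiagonal_of_summable_norm s1 s2
  rw [(hasSum_pochC_mul_pow _ hT1).tsum_eq, (hasSum_pochC_mul_pow _ hT2).tsum_eq] at h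
  simp only [← hterm] at h
  rw [h]
  exact s.of_norm.hasSum

end MeixnerPollaczek

section Mobius

open Filter Topology

theorem one_sub_add_mul_mem_slitPlane {w : ℂ} (hw : w ∈ Complex.slitPlane) {t : ℝ}
    (ht : t ∈ Icc (0 : ℝ) 1) : (1 - t + t * w : ℂ) ∈ Complex.slitPlane := by
  simpa using Complex.starConvex_one_slitPlane hw (sub_nonneg.2 ht.2) ht.1 (sub_add_cancel 1 t)

theorem mul_mem_slitPlane_of_re_pos {c d : ℂ} (hc : 0 < c.re) (hd : 0 < d.re) :
    c * d ∈ Complex.slitPlane := by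
  rw [Complex.mem_slitPlane_iff, or_iff_not_imp_right, not_not]
  intro h
  rw [Complex.mul_im] at h
  rw [Complex.mul_re]
  have : 0 < c.re * (c.re * d.re - c.im * d.im) := by
    have e : c.re * (c.re * d.re - c.im * d.im) = (c.re ^ 2 + c.im ^ 2) * d.re := by
      linear_combination (-c.im) * h
    rw [e]
    positivity
  exact pos_of_mul_pos_right this hc.le

theorem ofReal_mul_cpow {r : ℝ} (hr : 0 < r) {w : ℂ} (hw : w ≠ 0) (s : ℂ) :
    (r * w) ^ s = (r : ℂ) ^ s * w ^ s := by
  have hr' : (r : ℂ) ≠ 0 := by exact_mod_cast hr.ne'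
  rw [Complex.cpow_def_of_ne_zero (mul_ne_zero hr' hw), Complex.cpow_def_of_ne_zero hr',
    Complex.cpow_def_of_ne_zero hw, Complex.log_ofReal_mul hr hw, ← Complex.exp_add,
    Complex.ofReal_log hr.le, add_mul]

theorem differentiableOn_integral_mul_cpow {w A B : ℝ → ℂ} {U : Set ℂ} (p : ℂ)
    (hw : IntervalIntegrable w volume 0 1) (hA : ContinuousOn A (Icc 0 1))
    (hB : ContinuousOn B (Icc 0 1)) (hU : IsOpen U)
    (h : ∀ c ∈ U, ∀ t ∈ Icc (0 : ℝ) 1, A t * c + B t ∈ Complex.slitPlane) :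
    DifferentiableOn ℂ (fun c => ∫ t in (0 : ℝ)..1, w t * (A t * c + B t) ^ p) U := by
  intro c₀ hc₀
  obtain ⟨r, hr, hrU⟩ := Metric.nhds_basis_closedBall.mem_iff.1 (hU.mem_nhds hc₀)
  have hI : uIcc (0 : ℝ) 1 = Icc 0 1 := uIcc_of_le zero_le_one
  have hIoc : ∀ t ∈ uIoc (0 : ℝ) 1, t ∈ Icc (0 : ℝ) 1 := fun t ht =>
    hI ▸ uIoc_subset_uIcc ht
  have hcont : ∀ (q : ℂ), ∀ c ∈ U, ContinuousOn (fun t => (A t * c + B t) ^ q) (uIcc 0 1) := by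
    intro q c hc
    rw [hI]
    exact ((hA.mul continuousOn_const).add hB).cpow_const fun t ht => h c hc t ht
  have hF : ∀ c ∈ U, IntervalIntegrable (fun t => w t * (A t * c + B t) ^ p) volume 0 1 :=
    fun c hc => hw.mul_continuousOn (hcont p c hc)
  have hF' : ∀ c ∈ U, IntervalIntegrable
      (fun t => w t * (p * (A t * c + B t) ^ (p - 1) * A t)) volume 0 1 := fun c hc =>
    hw.mul_continuousOn ((continuousOn_const.mul (hcont _ c hc)).mul (hI ▸ hA))
  obtain ⟨M, hM⟩ := ((isCompact_closedBall c₀ r).prod (isCompact_Icc (a := (0 : ℝ)) (b := 1))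
    ).exists_bound_of_continuousOn
      (f := fun q : ℂ × ℝ => p * (A q.2 * q.1 + B q.2) ^ (p - 1) * A q.2) (by
        have hA' : ContinuousOn (fun q : ℂ × ℝ => A q.2) (Metric.closedBall c₀ r ×ˢ Icc 0 1) :=
          hA.comp continuousOn_snd fun q hq => hq.2
        have hB' : ContinuousOn (fun q : ℂ × ℝ => B q.2) (Metric.closedBall c₀ r ×ˢ Icc 0 1) :=
          hB.comp continuousOn_snd fun q hq => hq.2
        exact (continuousOn_const.mul (((hA'.mul continuousOn_fst).add hB').cpow_const
          fun q hq => h q.1 (hrU hq.1) q.2 hq.2)).mul hA')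
  refine (intervalIntegral.hasDerivAt_integral_of_dominated_loc_of_deriv_le
    (F' := fun c t => w t * (p * (A t * c + B t) ^ (p - 1) * A t))
    (bound := fun t => ‖w t‖ * M) (Metric.closedBall_mem_nhds c₀ hr)
    ?_ (hF c₀ hc₀) (hF' c₀ hc₀).def'.aestronglyMeasurable ?_ (hw.norm.mul_const M)
    ?_).2.differentiableAt.differentiableWithinAt
  · filter_upwards [hU.mem_nhds hc₀] with c hc using (hF c hc).def'.aestronglyMeasurable
  · refine Eventually.of_forall fun t ht c hc => ?_
    rw [norm_mul]
    exact mul_le_mul_of_nonneg_left (hM (c, t) ⟨hc, hIoc t ht⟩) (norm_nonneg _)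
  · refine Eventually.of_forall fun t ht c hc => HasDerivAt.const_mul _ ?_
    have hlin : HasDerivAt (fun c => A t * c + B t) (A t) c := by
      simpa using ((hasDerivAt_id c).const_mul (A t)).add_const (B t)
    exact hlin.cpow_const (h c (hrU hc) t (hIoc t ht))

variable {a b : ℂ}

theorem integral_betaWeight_mobius_ofReal {c : ℝ} (hc : 0 < c) {d : ℂ} (hd : 0 < d.re) :
    ∫ t in (0 : ℝ)..1, betaWeight a b t * ((1 - t + t * d) ^ (-a) * ((1 - t) * c + t) ^ (-b)) =
      (c : ℂ) ^ (a - b) *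
        ∫ t in (0 : ℝ)..1, betaWeight a b t * (1 - t + t * (c * d)) ^ (-a) := by
  rw [← intervalIntegral.integral_const_mul, intervalIntegral.integral_of_le zero_le_one,
    intervalIntegral.integral_of_le zero_le_one, integral_Ioc_eq_integral_Ioo,
    integral_Ioc_eq_integral_Ioo]
  have hn : ∀ u ∈ Ioo (0 : ℝ) 1, 0 < c * u + (1 - u) := fun u hu => by
    have := mul_pos hc hu.1
    linarith [hu.2]
  have himg : (fun u : ℝ => c * u / (c * u + (1 - u))) '' Ioo 0 1 = Ioo 0 1 := by
    ext t
    constructor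
    · rintro ⟨u, hu, rfl⟩
      have h1 := hn u hu
      refine ⟨div_pos (mul_pos hc hu.1) h1, (div_lt_one h1).2 ?_⟩
      linarith [hu.2]
    · intro ht
      have h1 : 0 < t + c * (1 - t) := by
        have := mul_pos hc (sub_pos.2 ht.2)
        linarith [ht.1]
      refine ⟨t / (t + c * (1 - t)), ⟨div_pos ht.1 h1, (div_lt_one h1).2 ?_⟩, ?_⟩
      · have := mul_pos hc (sub_pos.2 ht.2)
        linarith
      · have e : c * (t / (t + c * (1 - t))) + (1 - t / (t + c * (1 - t))) =
            c / (t + c * (1 - t)) := by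
          field_simp
          ring
        simp only [e]
        field_simp
  have hderiv : ∀ u ∈ Ioo (0 : ℝ) 1,
      HasDerivWithinAt (fun u : ℝ => c * u / (c * u + (1 - u))) (c / (c * u + (1 - u)) ^ 2)
        (Ioo 0 1) u := by
    intro u hu
    have h1 : HasDerivAt (fun u : ℝ => c * u) c u := by
      simpa using (hasDerivAt_id u).const_mul c
    have h2 : HasDerivAt (fun u : ℝ => c * u + (1 - u)) (c + -1) u :=
      h1.add (by simpa using (hasDerivAt_id u).const_sub 1)
    exact ((h1.div h2 (hn u hu).ne').congr_deriv (by congr 1; ring)).hasDerivWithinAt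
  have hinj : InjOn (fun u : ℝ => c * u / (c * u + (1 - u))) (Ioo 0 1) := by
    intro u hu v hv huv
    have := (div_eq_div_iff (hn u hu).ne' (hn v hv).ne').1 huv
    have h2 : c * (u - v) = 0 := by linear_combination this
    rcases mul_eq_zero.1 h2 with h | h
    · exact absurd h hc.ne'
    · linarith
  conv_lhs => rw [← himg]
  rw [integral_image_eq_integral_abs_deriv_smul measurableSet_Ioo hderiv hinj]
  refine setIntegral_congr_fun measurableSet_Ioo fun u hu => ?_
  obtain ⟨ν, hν⟩ : ∃ ν : ℝ, ν = (c * u + (1 - u))⁻¹ := ⟨_, rfl⟩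
  have hν0 : 0 < ν := hν ▸ inv_pos.2 (hn u hu)
  have hν1 : ν * (c * u + (1 - u)) = 1 := hν ▸ inv_mul_cancel₀ (hn u hu).ne'
  have hν1' : (ν : ℂ) * (c * u + (1 - u)) = 1 := by exact_mod_cast hν1
  have hνc : (ν : ℂ) ≠ 0 := by exact_mod_cast hν0.ne'
  have hcc : (c : ℂ) ≠ 0 := by exact_mod_cast hc.ne'
  have huc : (u : ℂ) ≠ 0 := by exact_mod_cast hu.1.ne'
  have hu1 : (1 - u : ℂ) ≠ 0 := by exact_mod_cast (sub_pos.2 hu.2).ne'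
  have hs : (1 - u + u * (c * d) : ℂ) ≠ 0 := Complex.slitPlane_ne_zero
    (one_sub_add_mul_mem_slitPlane (mul_mem_slitPlane_of_re_pos (by simpa) hd)
      (Ioo_subset_Icc_self hu))
  have e1 : c * u / (c * u + (1 - u)) = ν * (c * u) := by rw [hν]; field_simp
  have e2 : |c / (c * u + (1 - u)) ^ 2| = c * ν ^ 2 := by
    rw [abs_of_pos (by have := hn u hu; positivity), hν, inv_pow, div_eq_mul_inv]
  simp only [betaWeight, e1, e2, Complex.real_smul]
  push_cast
  have e3 : (1 - (ν : ℂ) * (c * u)) = ν * (1 - u) := by linear_combination -hν1'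
  have e4 : (ν : ℂ) * (1 - u) + ν * (c * u) * d = ν * (1 - u + u * (c * d)) := by ring
  have e5 : (ν : ℂ) * (1 - u) * c + ν * (c * u) = ν * c := by ring
  rw [e3, e4, e5, ofReal_mul_cpow hν0 (mul_ne_zero hcc huc), ofReal_mul_cpow hc huc,
    ofReal_mul_cpow hν0 hu1, ofReal_mul_cpow hν0 hs, ofReal_mul_cpow hν0 hcc]
  have p1 : (ν : ℂ) ^ 2 * ((ν : ℂ) ^ (a - 1) * (ν : ℂ) ^ (b - 1) * (ν : ℂ) ^ (-a) *
      (ν : ℂ) ^ (-b)) = 1 := by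
    rw [← Complex.cpow_add _ _ hνc, ← Complex.cpow_add _ _ hνc, ← Complex.cpow_add _ _ hνc,
      ← Complex.cpow_natCast, ← Complex.cpow_add _ _ hνc]
    convert Complex.cpow_zero _ using 2
    push_cast
    ring
  have p2 : (c : ℂ) * ((c : ℂ) ^ (a - 1) * (c : ℂ) ^ (-b)) = (c : ℂ) ^ (a - b) := by
    conv_lhs => enter [1]; rw [← Complex.cpow_one (c : ℂ)]
    rw [← Complex.cpow_add _ _ hcc, ← Complex.cpow_add _ _ hcc]
    congr 1
    ring
  rw [← p2]
  linear_combination (c : ℂ) * ((c : ℂ) ^ (a - 1) * (c : ℂ) ^ (-b)) * (u : ℂ) ^ (a - 1) *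
    (1 - u : ℂ) ^ (b - 1) * (1 - u + u * (c * d) : ℂ) ^ (-a) * p1

theorem integral_betaWeight_mobius (ha : 0 < a.re) (hb : 0 < b.re) {c d : ℂ} (hc : 0 < c.re)
    (hd : 0 < d.re) :
    ∫ t in (0 : ℝ)..1, betaWeight a b t * ((1 - t + t * d) ^ (-a) * ((1 - t) * c + t) ^ (-b)) =
      c ^ (a - b) *
        ∫ t in (0 : ℝ)..1, betaWeight a b t * (1 - t + t * (c * d)) ^ (-a) := by
  have hU : IsOpen {c : ℂ | 0 < c.re} := isOpen_lt continuous_const Complex.continuous_re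
  have hw := intervalIntegrable_betaWeight ha hb
  have hL : DifferentiableOn ℂ (fun c : ℂ => ∫ t in (0 : ℝ)..1, betaWeight a b t *
      ((1 - t + t * d) ^ (-a) * ((1 - t) * c + t) ^ (-b))) {c : ℂ | 0 < c.re} := by
    have := differentiableOn_integral_mul_cpow (A := fun t => 1 - t) (B := fun t => t) (-b)
      (intervalIntegrable_betaWeight_mul ha hb (f := fun t => (1 - t + t * d) ^ (-a))
        (ContinuousOn.cpow_const (by fun_prop) fun t ht =>
          one_sub_add_mul_mem_slitPlane (Or.inl hd) ht))
      (by fun_prop) (by fun_prop) hU (fun c hc t ht => by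
        have h := one_sub_add_mul_mem_slitPlane (w := c) (t := 1 - t) (Or.inl hc)
          ⟨sub_nonneg.2 ht.2, by linarith [ht.1]⟩
        convert h using 1
        push_cast
        ring)
    simpa only [mul_assoc] using this
  have hR : DifferentiableOn ℂ (fun c : ℂ => c ^ (a - b) *
      ∫ t in (0 : ℝ)..1, betaWeight a b t * (1 - t + t * (c * d)) ^ (-a)) {c : ℂ | 0 < c.re} := by
    have := differentiableOn_integral_mul_cpow (A := fun t => t * d) (B := fun t => 1 - t) (-a)
      hw (by fun_prop) (by fun_prop) hU (fun c hc t ht => by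
        have h := one_sub_add_mul_mem_slitPlane (mul_mem_slitPlane_of_re_pos hc hd) ht
        convert h using 1
        ring)
    refine DifferentiableOn.mul
      (DifferentiableOn.cpow_const differentiableOn_id fun c hc => Or.inl hc) ?_
    have e : ∀ (c : ℂ) (t : ℝ), (1 - t + t * (c * d) : ℂ) = t * d * c + (1 - t) :=
      fun c t => by ring
    simpa only [e] using this
  refine (hL.analyticOnNhd hU).eqOn_of_preconnected_of_frequently_eq (hR.analyticOnNhd hU)
    (convex_halfSpace_re_gt 0).isPreconnected (z₀ := 1) (by simp) ?_ hc
  have htend : Tendsto ((↑) : ℝ → ℂ) (𝓝[≠] 1) (𝓝[≠] 1) := by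
    refine tendsto_nhdsWithin_iff.2 ⟨?_, ?_⟩
    · exact (by simpa using Complex.continuous_ofReal.tendsto 1 :
        Tendsto ((↑) : ℝ → ℂ) (𝓝 1) (𝓝 1)).mono_left nhdsWithin_le_nhds
    · filter_upwards [self_mem_nhdsWithin] with y hy
      simpa using hy
  refine htend.frequently (Eventually.frequently ?_)
  filter_upwards [nhdsWithin_le_nhds (lt_mem_nhds zero_lt_one)] with y hy
  exact integral_betaWeight_mobius_ofReal hy hd

end Mobius

theorem normalization_factor
    (θ γ β ε x : ℝ) (hθ : θ ∈ Set.Ioo 0 π) (hγ : 1 < γ) (hβ : 0 < β) (hε : 0 < ε)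
    (μ : ℝ) (hμ : μ = Real.exp (-4 * ε * β))
    (z : ℂ) (hz : z = -4 * (μ : ℂ) * (Real.sin θ : ℂ) ^ 2 / (1 - (μ : ℂ)) ^ 2) :
    (Summable fun m : ℕ =>
      ‖((m.factorial : ℂ) / (pochR γ m : ℂ)) * (μ : ℂ) ^ m *
        (meixnerPollaczek (γ / 2) θ x m) ^ 2‖) ∧
    (Real.exp (-2 * ε * β * γ) : ℂ) *
        ∑' m : ℕ, ((m.factorial : ℂ) / (pochR γ m : ℂ)) * (μ : ℂ) ^ m *
          (meixnerPollaczek (γ / 2) θ x m) ^ 2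
      = ((1 - (μ : ℂ) * Complex.exp (2 * Complex.I * θ)) / (1 - (μ : ℂ)))
            ^ (2 * Complex.I * x) *
        ((2 * Real.sinh (2 * ε * β)) ^ (-γ) : ℝ) *
        ((Complex.Gamma γ /
            (Complex.Gamma (γ / 2 + Complex.I * x) * Complex.Gamma (γ / 2 - Complex.I * x))) *
          ∫ t in (0 : ℝ)..1,
            (t : ℂ) ^ (γ / 2 + Complex.I * x - 1) *
              ((1 - t : ℝ) : ℂ) ^ (γ / 2 - Complex.I * x - 1) *
              (1 - z * t) ^ (-(γ / 2 + Complex.I * x))) := by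
  have hγ0 : 0 < γ / 2 := by linarith
  obtain ⟨a, ha_def⟩ : ∃ a : ℂ, a = γ / 2 + Complex.I * x := ⟨_, rfl⟩
  obtain ⟨b, hb_def⟩ : ∃ b : ℂ, b = γ / 2 - Complex.I * x := ⟨_, rfl⟩
  have hlam : ((γ / 2 : ℝ) : ℂ) = γ / 2 := by push_cast; rfl
  have h2lam : 2 * ((γ / 2 : ℝ) : ℂ) = γ := by push_cast; ring
  have hre : (γ / 2 : ℂ).re = γ / 2 := by rw [← hlam, Complex.ofReal_re]
  have ha : 0 < a.re := by simp only [ha_def, Complex.add_re, hre]; simp; linarith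
  have hb : 0 < b.re := by simp only [hb_def, Complex.sub_re, hre]; simp; linarith
  have hab : a + b = γ := by rw [ha_def, hb_def]; ring
  have hamb : a - b = 2 * Complex.I * x := by rw [ha_def, hb_def]; ring
  have hμ0 : 0 < μ := hμ ▸ Real.exp_pos _
  have hμ1 : μ < 1 := by
    rw [hμ, Real.exp_lt_one_iff]
    have := mul_pos hε hβ
    linarith
  have hq : 0 < 1 - μ := sub_pos.2 hμ1
  have hqc : (1 - μ : ℂ) ≠ 0 := by exact_mod_cast hq.ne'
  obtain ⟨E, hE⟩ : ∃ E, E = Complex.exp (Complex.I * θ) := ⟨_, rfl⟩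
  obtain ⟨E', hE'⟩ : ∃ E', E' = Complex.exp (-(Complex.I * θ)) := ⟨_, rfl⟩
  have hEE' : E * E' = 1 := by rw [hE, hE', ← Complex.exp_add]; simp
  have hnE : ‖E‖ = 1 := by rw [hE, mul_comm, Complex.norm_exp_ofReal_mul_I]
  have hnE' : ‖E'‖ = 1 := by
    have := congrArg norm hEE'
    simpa [hnE] using this
  have hE2 : Complex.exp (2 * Complex.I * θ) = E ^ 2 := by
    rw [hE, ← Complex.exp_nat_mul]; congr 1; push_cast; ring
  have hE2' : Complex.exp (-2 * Complex.I * θ) = E' ^ 2 := by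
    rw [hE', ← Complex.exp_nat_mul]; congr 1; push_cast; ring
  have hsin : (Real.sin θ : ℂ) = (E' - E) * Complex.I / 2 := by
    rw [Complex.ofReal_sin, Complex.sin, hE, hE', mul_comm Complex.I, neg_mul]
  obtain ⟨c, hc_def⟩ : ∃ c : ℂ, c = (1 - μ * E ^ 2) / (1 - μ) := ⟨_, rfl⟩
  obtain ⟨d, hd_def⟩ : ∃ d : ℂ, d = (1 - μ * E' ^ 2) / (1 - μ) := ⟨_, rfl⟩
  have hpos : ∀ w : ℂ, ‖w‖ = 1 → 0 < ((1 - μ * w ^ 2) / (1 - μ) : ℂ).re := by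
    intro w hw
    have e : ((1 - μ * w ^ 2) / (1 - μ) : ℂ) = (1 - μ * w ^ 2) / ((1 - μ : ℝ) : ℂ) := by
      push_cast; rfl
    rw [e, Complex.div_ofReal_re]
    refine div_pos ?_ hq
    have h1 := Complex.re_le_norm (μ * w ^ 2)
    rw [norm_mul, norm_pow, hw, Complex.norm_real, Real.norm_of_nonneg hμ0.le] at h1
    rw [Complex.sub_re, Complex.one_re]
    linarith
  have hc : 0 < c.re := hc_def ▸ hpos E hnE
  have hd : 0 < d.re := hd_def ▸ hpos E' hnE'
  have hcd : c * d = 1 - z := by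
    rw [hc_def, hd_def, hz, hsin]
    field_simp
    linear_combination (4 * (μ ^ 2 * (E * E' + 1) - 2 * μ) : ℂ) * hEE' -
      (4 * (μ * (E' - E) ^ 2) : ℂ) * Complex.I_sq
  obtain ⟨T, hT⟩ : ∃ T : ℝ → ℂ, ∀ t, T t = μ * (E * (1 - t + E' ^ 2 * t)) :=
    ⟨_, fun _ => rfl⟩
  have hTle : ∀ t ∈ Icc (0 : ℝ) 1, ‖T t‖ ≤ μ := by
    intro t ht
    have h1 : ‖(1 - t + E' ^ 2 * t : ℂ)‖ ≤ 1 := by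
      refine (norm_add_le _ _).trans ?_
      rw [norm_mul, norm_pow, hnE', ← Complex.ofReal_one, ← Complex.ofReal_sub, Complex.norm_real,
        Complex.norm_real, Real.norm_of_nonneg ht.1, Real.norm_of_nonneg (sub_nonneg.2 ht.2)]
      linarith
    rw [hT, norm_mul, norm_mul, hnE, one_mul, Complex.norm_real, Real.norm_of_nonneg hμ0.le]
    exact mul_le_of_le_one_right hμ0.le h1
  have hgen : ∀ t ∈ Icc (0 : ℝ) 1,
      HasSum (fun m => meixnerPollaczek (γ / 2) θ x m * T t ^ m)
        (((1 - μ : ℝ) : ℂ) ^ (-(γ : ℂ)) *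
          ((1 - t + t * d) ^ (-a) * ((1 - t) * c + t) ^ (-b))) := by
    intro t ht
    have h := (summable_norm_and_hasSum_meixnerPollaczek hγ0 θ x
      ((hTle t ht).trans_lt hμ1)).2
    have e1 : 1 - E * T t = ((1 - μ : ℝ) : ℂ) * ((1 - t) * c + t) := by
      rw [hT, hc_def]
      push_cast
      field_simp
      linear_combination (-μ * t * (E * E' + 1) : ℂ) * hEE'
    have e2 : 1 - E' * T t = ((1 - μ : ℝ) : ℂ) * (1 - t + t * d) := by
      rw [hT, hd_def]
      push_cast
      field_simp
      linear_combination (-μ * (1 - t + E' ^ 2 * t) : ℂ) * hEE'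
    have n1 : ((1 - t) * c + t : ℂ) ≠ 0 := by
      have h := one_sub_add_mul_mem_slitPlane (w := c) (t := 1 - t) (Or.inl hc)
        ⟨sub_nonneg.2 ht.2, by linarith [ht.1]⟩
      convert Complex.slitPlane_ne_zero h using 1
      push_cast
      ring
    have n2 : (1 - t + t * d : ℂ) ≠ 0 :=
      Complex.slitPlane_ne_zero (one_sub_add_mul_mem_slitPlane (Or.inl hd) ht)
    rw [← hE, ← hE', hlam, ← ha_def, ← hb_def, e1, e2, ofReal_mul_cpow hq n1,
      ofReal_mul_cpow hq n2] at h
    convert h using 1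
    rw [← hab, neg_add, Complex.cpow_add _ _ (by exact_mod_cast hq.ne')]
    ring
  have hterm : ∀ m : ℕ, ((m.factorial : ℂ) / (pochR γ m : ℂ)) * (μ : ℂ) ^ m *
      (meixnerPollaczek (γ / 2) θ x m) ^ 2 =
      betaMean a b (fun t => meixnerPollaczek (γ / 2) θ x m * T t ^ m) := by
    intro m
    have hR : (pochR γ m : ℂ) = pochC γ m := by simp [pochR, pochC]
    have hP := meixnerPollaczek_eq_betaMean hγ0 θ x m
    have hexp : Complex.exp (Complex.I * m * θ) = E ^ m := by
      rw [hE, ← Complex.exp_nat_mul]; congr 1; ring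
    rw [h2lam, hlam, ← ha_def, ← hb_def, hE2', hexp] at hP
    have hT' : ∀ t, T t ^ m = (μ ^ m * E ^ m) * (1 - t + E' ^ 2 * t) ^ m := by
      intro t
      rw [hT, mul_pow, mul_pow, mul_assoc]
    simp only [hT', betaMean_const_mul]
    have h1 : pochC (γ : ℂ) m ≠ 0 :=
      pochC_ne_zero (by rw [Complex.ofReal_re]; linarith) m
    have h2 : (m.factorial : ℂ) ≠ 0 := by exact_mod_cast m.factorial_ne_zero
    generalize betaMean a b (fun t => (1 - t + E' ^ 2 * t) ^ m) = M at hP ⊢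
    rw [hR, pow_two]
    conv_lhs => enter [2, 2]; rw [hP]
    field_simp
  have hB := (summable_norm_and_hasSum_meixnerPollaczek hγ0 θ x (T := μ)
    (by rwa [Complex.norm_real, Real.norm_of_nonneg hμ0.le])).1
  obtain ⟨hS, hH⟩ := summable_norm_and_hasSum_betaMean ha hb
    (f := fun m t => meixnerPollaczek (γ / 2) θ x m * T t ^ m)
    (fun m => by simp only [hT]; fun_prop) hB
    (fun m t ht => by
      rw [norm_mul, norm_mul, norm_pow, norm_pow, Complex.norm_real, Real.norm_of_nonneg hμ0.le]
      gcongr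
      exact hTle t ht) hgen
  simp only [← hterm] at hS hH
  refine ⟨hS, ?_⟩
  rw [hH.tsum_eq, betaMean_const_mul, betaMean, integral_betaWeight_mobius ha hb hc hd, hE2,
    ← hc_def, ← hamb, ← ha_def, ← hb_def, hab, hcd]
  have hint : ∀ t : ℝ, (t : ℂ) ^ (a - 1) * ((1 - t : ℝ) : ℂ) ^ (b - 1) * (1 - z * t) ^ (-a) =
      betaWeight a b t * (1 - t + t * (1 - z)) ^ (-a) := by
    intro t
    have e : (1 - z * t : ℂ) = 1 - t + t * (1 - z) := by ring
    rw [e, betaWeight]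
    push_cast
    rfl
  simp only [hint]
  have hsinh : (Real.exp (-2 * ε * β * γ) : ℂ) * ((1 - μ : ℝ) : ℂ) ^ (-(γ : ℂ)) =
      ((2 * Real.sinh (2 * ε * β)) ^ (-γ) : ℝ) := by
    have e : 2 * Real.sinh (2 * ε * β) = Real.exp (2 * ε * β) * (1 - μ) := by
      rw [Real.sinh_eq, hμ, mul_sub, ← Real.exp_add]
      ring_nf
    rw [e, Real.mul_rpow (Real.exp_pos _).le hq.le, ← Real.exp_mul, ← Complex.ofReal_neg,
      ← Complex.ofReal_cpow hq.le, ← Complex.ofReal_mul]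
    ring_nf
  rw [← hsinh]
  ring
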